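/- arXiv:1901.09540 — 2 statements merged into one kernel-verified Lean document; each statement's English description precedes it below -/
import Mathlib

section
/- Let 𝔤 be a Lie algebra over a finite field F. Then 𝔤 cannot be covered by |F| proper Lie subalgebras; i.e., for any proper Lie subalgebras 𝔥₁,…,𝔥_{|F|} of 𝔤 there exists an element of 𝔤 lying in none of them. -/
/-- A vector space is not the union of `n` proper subspaces when the scalar field has at least
`n` elements. -/
theorem Submodule.exists_forall_notMem_of_card_le {F V ι : Type*} [Field F] [Fintype F]
    [AddCommGroup V] [Module F V] (p : ι → Submodule F V) (s : Finset ι)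
    (hs : s.card ≤ Fintype.card F) (hp : ∀ i ∈ s, p i ≠ ⊤) : ∃ x : V, ∀ i ∈ s, x ∉ p i := by
  classical
  induction s using Finset.induction_on with
  | empty => exact ⟨0, by simp⟩
  | insert a s ha ih =>
    rw [Finset.card_insert_of_notMem ha] at hs
    obtain ⟨x, hx⟩ := ih (by omega) fun i hi => hp i (Finset.mem_insert_of_mem hi)
    by_cases hxa : x ∈ p a
    · obtain ⟨y, hy⟩ : ∃ y, y ∉ p a := by
        by_contra! h
        exact hp a (Finset.mem_insert_self a s) (eq_top_iff.2 fun z _ => h z)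
      by_contra! hcover
      have hline : ∀ c : F, ∃ i ∈ s, y + c • x ∈ p i := by
        intro c
        obtain ⟨i, hi, hmem⟩ := hcover (y + c • x)
        rcases Finset.mem_insert.1 hi with rfl | hi
        · exact absurd (((p i).add_mem_iff_left ((p i).smul_mem c hxa)).1 hmem) hy
        · exact ⟨i, hi, hmem⟩
      choose f hfs hf using hline
      obtain ⟨c, -, d, -, hcd, hfcd⟩ := Finset.exists_ne_map_eq_of_card_lt_of_maps_to
        (s := Finset.univ) (t := s) (f := f) (by rw [Finset.card_univ]; omega)
        fun c _ => hfs c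
      have hd := hf d
      rw [← hfcd] at hd
      have hsub : (c - d) • x ∈ p (f c) := by
        convert (p (f c)).sub_mem (hf c) hd using 1
        rw [sub_smul]
        abel
      exact hx _ (hfs c) (((p (f c)).smul_mem_iff (sub_ne_zero.2 hcd)).1 hsub)
    · refine ⟨x, fun i hi => ?_⟩
      rcases Finset.mem_insert.1 hi with rfl | hi
      · exact hxa
      · exact hx i hi

/-- A Lie algebra over a finite field `F` cannot be covered by `|F|` proper Lie
subalgebras. -/
theorem stmt4 (F L : Type*) [Field F] [Fintype F] [LieRing L] [LieAlgebra F L]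
    (𝔥 : Fin (Fintype.card F) → LieSubalgebra F L) (hprop : ∀ i, 𝔥 i ≠ ⊤) :
    ∃ x : L, ∀ i, x ∉ 𝔥 i := by
  obtain ⟨x, hx⟩ := Submodule.exists_forall_notMem_of_card_le (fun i => (𝔥 i).toSubmodule)
    Finset.univ (by simp) fun i _ h => hprop i (LieSubalgebra.toSubmodule_injective h)
  exact ⟨x, fun i => hx i (Finset.mem_univ i)⟩
end

section
/- Let 𝔤 be a finite-dimensional Lie algebra and let 𝔥 be a Lie ideal of 𝔤 of codimension 1 (i.e., dim(𝔤/𝔥) = 1). Then for every element x ∈ 𝔤 \ 𝔥 one has dim [𝔤,𝔤] ≤ b(x) + dim [𝔥,𝔥]. -/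
/-- The breadth of an element `x` of a finite-dimensional Lie algebra:
`b(x) = dim 𝔤 - dim C_𝔤(x)`. -/
noncomputable def breadth (F : Type*) {L : Type*} [Field F] [LieRing L] [LieAlgebra F L]
    (x : L) : ℕ :=
  Module.finrank F L - Module.finrank F (LinearMap.ker ((LieAlgebra.ad F L x) : L →ₗ[F] L))

/-- An element outside a subspace of codimension one spans a complement to it. -/
theorem exists_sub_smul_mem_of_finrank_quotient_eq_one {F V : Type*} [Field F] [AddCommGroup V]
    [Module F V] {W : Submodule F V} (hW : Module.finrank F (V ⧸ W) = 1) {x : V} (hx : x ∉ W)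
    (a : V) : ∃ c : F, a - c • x ∈ W := by
  have hx' : W.mkQ x ≠ 0 := by simpa using hx
  obtain ⟨c, hc⟩ := (finrank_eq_one_iff_of_nonzero' (W.mkQ x) hx').mp hW (W.mkQ a)
  refine ⟨c, (Submodule.Quotient.mk_eq_zero W).mp ?_⟩
  change W.mkQ (a - c • x) = 0
  rw [map_sub, map_smul, hc, sub_self]

theorem breadth_eq_finrank_range_ad (F : Type*) {L : Type*} [Field F] [LieRing L]
    [LieAlgebra F L] [FiniteDimensional F L] (x : L) :
    breadth F x = Module.finrank F (LinearMap.range (LieAlgebra.ad F L x : L →ₗ[F] L)) := by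
  have h := LinearMap.finrank_range_add_finrank_ker (LieAlgebra.ad F L x : L →ₗ[F] L)
  unfold breadth
  omega

theorem derivedSeries_one_le_range_ad_sup {F L : Type*} [Field F] [LieRing L] [LieAlgebra F L]
    {I : LieIdeal F L} (hI : Module.finrank F (L ⧸ (I : Submodule F L)) = 1) {x : L}
    (hx : x ∉ I) :
    (LieAlgebra.derivedSeries F L 1).toSubmodule ≤
      LinearMap.range (LieAlgebra.ad F L x : L →ₗ[F] L) ⊔
        (⁅I, I⁆ : LieIdeal F L).toSubmodule := by
  rw [LieAlgebra.derivedSeries_def, LieAlgebra.derivedSeriesOfIdeal_succ,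
    LieAlgebra.derivedSeriesOfIdeal_zero, LieSubmodule.lieIdeal_oper_eq_linear_span',
    Submodule.span_le]
  rintro _ ⟨a, -, b, -, rfl⟩
  obtain ⟨c, hc⟩ := exists_sub_smul_mem_of_finrank_quotient_eq_one hI hx a
  obtain ⟨d, hd⟩ := exists_sub_smul_mem_of_finrank_quotient_eq_one hI hx b
  have key : ⁅a, b⁆ = ⁅x, c • b - d • a⁆ + ⁅a - c • x, b - d • x⁆ := by
    simp only [lie_sub, sub_lie, lie_smul, smul_lie, lie_self, smul_zero, ← lie_skew a x]
    module
  rw [key]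
  exact Submodule.add_mem_sup ⟨_, rfl⟩ (LieSubmodule.lie_mem_lie hc hd)

/-- If `𝔥` is an ideal of codimension `1` in a finite-dimensional Lie algebra `𝔤`, then for any
`x ∈ 𝔤 \ 𝔥` we have `dim [𝔤,𝔤] ≤ b(x) + dim [𝔥,𝔥]`. -/
theorem stmt9 (F L : Type*) [Field F] [LieRing L] [LieAlgebra F L] [FiniteDimensional F L]
    (𝔥 : LieIdeal F L) (hcodim : Module.finrank F (L ⧸ (𝔥 : Submodule F L)) = 1)
    (x : L) (hx : x ∉ 𝔥) :
    Module.finrank F (LieAlgebra.derivedSeries F L 1) ≤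
      breadth F x + Module.finrank F (⁅𝔥, 𝔥⁆ : LieIdeal F L) := by
  rw [breadth_eq_finrank_range_ad]
  exact (Submodule.finrank_mono (derivedSeries_one_le_range_ad_sup hcodim hx)).trans
    (Submodule.finrank_add_le_finrank_add_finrank _ _)
end
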